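/- Let m and n be positive integers and let A be an m×n matrix over a commutative ring. Then ( Σ_{I⊆[n], |I|=m} det(Aᴵ) )² = det( A·(2·U_n + Id_n)·Aᵗ ). -/

import Mathlib

open Matrix

/-- Strictly increasing functions `Fin m → Fin n`; these encode the `m`-element
subsets of `{1,…,n}` listed in increasing order. -/
def incrFuns (m n : ℕ) : Finset (Fin m → Fin n) :=
  Finset.univ.filter fun f => ∀ a b : Fin m, a < b → f a < f b

/-- The `n × n` strictly upper triangular matrix `U_n` with all entries above the
diagonal equal to `1` and all other entries equal to `0`. -/
def upperTri (R : Type*) [CommRing R] (n : ℕ) : Matrix (Fin n) (Fin n) R :=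
  Matrix.of fun i j => if i < j then 1 else 0

namespace Byun

open Finset

theorem sum_incr_zero {M : Type*} [AddCommMonoid M] (n : ℕ) (F : (Fin 0 → Fin n) → M) :
    ∑ f ∈ incrFuns 0 n, F f = F Fin.elim0 := by
  have : incrFuns 0 n = {Fin.elim0} := by
    ext f
    simp [incrFuns, eq_iff_true_of_subsingleton]
  rw [this, sum_singleton]

theorem sum_incr_succ_zero {M : Type*} [AddCommMonoid M] (k : ℕ) (F : (Fin (k+1) → Fin 0) → M) :
    ∑ f ∈ incrFuns (k+1) 0, F f = 0 := by
  apply sum_eq_zero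
  intro f _
  exact (f 0).elim0

theorem sum_incr_succ_succ {M : Type*} [AddCommMonoid M] (k n : ℕ)
    (F : (Fin (k+1) → Fin (n+1)) → M) :
    ∑ f ∈ incrFuns (k+1) (n+1), F f
      = ∑ g ∈ incrFuns (k+1) n, F (fun i => (g i).succ)
        + ∑ g ∈ incrFuns k n, F (Fin.cons 0 (fun i => (g i).succ)) := by
  rw [← sum_filter_not_add_sum_filter _ (fun f : Fin (k+1) → Fin (n+1) => f 0 = 0)]
  congr 1
  · symm
    apply sum_bij (fun (g : Fin (k+1) → Fin n) _ => fun i => (g i).succ)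
    · intro g hg
      simp only [incrFuns, mem_filter, mem_univ, true_and] at hg ⊢
      exact ⟨fun a b h => Fin.succ_lt_succ_iff.2 (hg a b h), Fin.succ_ne_zero _⟩
    · intro g _ g' _ h
      funext i
      exact Fin.succ_injective _ (congrFun h i)
    · intro f hf
      simp only [incrFuns, mem_filter, mem_univ, true_and] at hf
      obtain ⟨hf, h0⟩ := hf
      have hne : ∀ i, f i ≠ 0 := by
        intro i
        rcases Fin.eq_zero_or_eq_succ i with rfl | ⟨j, rfl⟩
        · exact h0
        · have := hf 0 j.succ (Fin.succ_pos j)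
          exact Fin.ne_zero_of_lt this
      refine ⟨fun i => (f i).pred (hne i), ?_, ?_⟩
      · simp only [incrFuns, mem_filter, mem_univ, true_and]
        intro a b h
        exact Fin.pred_lt_pred_iff.2 (hf a b h)
      · funext i; simp
    · intros; rfl
  · symm
    apply sum_bij (fun (g : Fin k → Fin n) _ => (Fin.cons 0 (fun i => (g i).succ) : Fin (k+1) → Fin (n+1)))
    · intro g hg
      simp only [incrFuns, mem_filter, mem_univ, true_and] at hg ⊢
      refine ⟨fun a b h => ?_, rfl⟩
      rcases Fin.eq_zero_or_eq_succ b with rfl | ⟨b, rfl⟩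
      · exact absurd h (Fin.not_lt_zero a)
      rcases Fin.eq_zero_or_eq_succ a with rfl | ⟨a, rfl⟩
      · simp
      · simpa using hg a b (Fin.succ_lt_succ_iff.1 h)
    · intro g _ g' _ h
      funext i
      have := congrFun h i.succ
      simpa using this
    · intro f hf
      simp only [incrFuns, mem_filter, mem_univ, true_and] at hf
      obtain ⟨hf, h0⟩ := hf
      have hne : ∀ i : Fin k, f i.succ ≠ 0 := fun j =>
        Fin.ne_zero_of_lt (hf 0 j.succ (Fin.succ_pos j))
      refine ⟨fun i => (f i.succ).pred (hne i), ?_, ?_⟩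
      · simp only [incrFuns, mem_filter, mem_univ, true_and]
        intro a b h
        exact Fin.pred_lt_pred_iff.2 (hf _ _ (Fin.succ_lt_succ_iff.2 h))
      · funext i
        rcases Fin.eq_zero_or_eq_succ i with rfl | ⟨i, rfl⟩
        · simp [h0]
        · simp
    · intros; rfl

/-- the matrix `2 U + 1` -/
abbrev MM (R : Type*) [CommRing R] (n : ℕ) : Matrix (Fin n) (Fin n) R := 2 • upperTri R n + 1

section ext
variable {R V : Type*} [CommRing R] [AddCommGroup V] [Module R V]

/-- the ordered product of `1 + a i` in the exterior algebra -/
noncomputable def EE : (n : ℕ) → (Fin n → V) → ExteriorAlgebra R V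
  | 0, _ => 1
  | n+1, a => (1 + ExteriorAlgebra.ι R (a 0)) * EE n (fun i => a i.succ)

theorem lift_EE (n : ℕ) (a : Fin n → V) (f : ∀ i, V [⋀^Fin i]→ₗ[R] R) (N : ℕ) (hN : n < N) :
    ExteriorAlgebra.liftAlternating f (EE (R := R) n a)
      = ∑ k ∈ range N, ∑ g ∈ incrFuns k n, f k (fun i => a (g i)) := by
  induction n generalizing f N with
  | zero =>
    obtain ⟨N, rfl⟩ : ∃ N', N = N' + 1 := ⟨N - 1, by omega⟩
    rw [sum_range_succ']
    simp only [sum_incr_succ_zero, sum_incr_zero, sum_const_zero, zero_add]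
    rw [EE, ExteriorAlgebra.liftAlternating_one]
    congr 1
    exact Subsingleton.elim _ _
  | succ n ih =>
    obtain ⟨N, rfl⟩ : ∃ N', N = N' + 1 := ⟨N - 1, by omega⟩
    rw [sum_range_succ']
    simp only [sum_incr_succ_succ, sum_incr_zero, sum_add_distrib]
    rw [EE, add_mul, one_mul, map_add, ExteriorAlgebra.liftAlternating_ι_mul,
      ih _ _ (N+1) (by omega), ih _ _ N (by omega), sum_range_succ', sum_incr_zero, add_right_comm]
    congr 1
    · congr 1
      refine sum_congr rfl fun k _ => sum_congr rfl fun g _ => ?_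
      rw [AlternatingMap.curryLeft_apply_apply]
      congr 1
      funext i
      rcases Fin.eq_zero_or_eq_succ i with rfl | ⟨i, rfl⟩ <;> simp
    · congr 1
      exact Subsingleton.elim _ _

theorem contract_EE (n : ℕ) (a : Fin n → V) (φ : Module.Dual R V) :
    CliffordAlgebra.contractLeft (Q := (0 : QuadraticForm R V)) φ (EE (R := R) n a)
      = φ (∑ i, a i) • EE (R := R) n a
        - ExteriorAlgebra.ι R (∑ i, (∑ j, MM R n i j * φ (a j)) • a i)
          * EE (R := R) n a := by
  induction n with
  | zero => simp [EE]
  | succ n ih =>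
    set b : Fin n → V := fun i => a i.succ with hb
    set q : V := ∑ i, (∑ j, MM R n i j * φ (b j)) • b i with hq
    have e1 : ∑ i, a i = a 0 + ∑ i, b i := Fin.sum_univ_succ _
    have e2 : ∑ i, (∑ j, MM R (n+1) i j * φ (a j)) • a i
        = q + (φ (a 0) + 2 * φ (∑ i, b i)) • a 0 := by
      rw [Fin.sum_univ_succ, add_comm]
      congr 1
      · refine sum_congr rfl fun i _ => ?_
        congr 1
        rw [Fin.sum_univ_succ]
        simp [MM, upperTri, Matrix.one_apply, hb]
      · congr 1
        rw [Fin.sum_univ_succ]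
        simp [MM, upperTri, Matrix.one_apply, hb, mul_sum, (Fin.succ_ne_zero _).symm]
    rw [e1, e2]
    simp only [EE]
    change CliffordAlgebra.contractLeft (Q := (0 : QuadraticForm R V)) φ ((1 + ExteriorAlgebra.ι R (a 0)) * EE (R := R) n b) = φ (a 0 + ∑ i, b i) • ((1 + ExteriorAlgebra.ι R (a 0)) * EE (R := R) n b) - ExteriorAlgebra.ι R (q + (φ (a 0) + 2 * φ (∑ i, b i)) • a 0) * ((1 + ExteriorAlgebra.ι R (a 0)) * EE (R := R) n b)
    have ih' := ih b
    rw [← hq] at ih'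
    have h1 : CliffordAlgebra.contractLeft (Q := (0 : QuadraticForm R V)) φ ((1 + ExteriorAlgebra.ι R (a 0)) * EE (R := R) n b)
       = CliffordAlgebra.contractLeft (Q := (0 : QuadraticForm R V)) φ (EE (R := R) n b) + (φ (a 0) • EE (R := R) n b - ExteriorAlgebra.ι R (a 0) * CliffordAlgebra.contractLeft (Q := (0 : QuadraticForm R V)) φ (EE (R := R) n b)) := by
      rw [add_mul, one_mul, map_add]
      congr 1
      exact CliffordAlgebra.contractLeft_ι_mul _ _ _
    rw [h1, ih', map_add φ]
    generalize EE (R := R) n b = X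
    generalize φ (∑ i, b i) = s
    have hww : ExteriorAlgebra.ι R (a 0) * ExteriorAlgebra.ι R (a 0) = 0 :=
      ExteriorAlgebra.ι_sq_zero _
    have hqw : ExteriorAlgebra.ι R q * ExteriorAlgebra.ι R (a 0)
        = - (ExteriorAlgebra.ι R (a 0) * ExteriorAlgebra.ι R q) :=
      eq_neg_of_add_eq_zero_left (ExteriorAlgebra.ι_add_mul_swap _ _)
    rw [map_add, map_smul]
    generalize ExteriorAlgebra.ι R (a 0) = u at hww hqw ⊢
    generalize ExteriorAlgebra.ι R q = w at hqw ⊢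
    generalize φ (a 0) = t
    simp only [add_mul, mul_add, one_mul, smul_mul_assoc, mul_smul_comm, mul_sub, ← mul_assoc,
      hww, hqw, neg_mul, zero_mul, smul_zero]
    module
end ext
end Byun
namespace Byun
open Finset

section top
variable {R : Type*} [CommRing R]

/-- determinant in degree `m`, zero in other degrees -/
noncomputable def topf (R : Type*) [CommRing R] (m : ℕ) :
    ∀ i, (Fin m → R) [⋀^Fin i]→ₗ[R] R :=
  Function.update (0 : ∀ i, (Fin m → R) [⋀^Fin i]→ₗ[R] R) m Matrix.detRowAlternating

theorem topf_self (m : ℕ) : topf R m m = Matrix.detRowAlternating := Function.update_self _ _ _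

theorem topf_ne (m k : ℕ) (h : k ≠ m) : topf R m k = 0 := Function.update_of_ne h _ _

theorem contract_mem {V : Type*} [AddCommGroup V] [Module R V] (φ : Module.Dual R V) (k : ℕ)
    (v : Fin (k+1) → V) :
    CliffordAlgebra.contractLeft (Q := (0 : QuadraticForm R V)) φ (ExteriorAlgebra.ιMulti R (k+1) v)
      ∈ Submodule.span R (Set.range (ExteriorAlgebra.ιMulti R (M := V) k)) := by
  induction k with
  | zero =>
    rw [ExteriorAlgebra.ιMulti_succ_apply]
    have := CliffordAlgebra.contractLeft_ι_mul (Q := (0 : QuadraticForm R V)) φ (v 0)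
      (ExteriorAlgebra.ιMulti R 0 (Matrix.vecTail v))
    refine this ▸ ?_
    refine Submodule.sub_mem _ (Submodule.smul_mem _ _ (Submodule.subset_span ⟨_, rfl⟩)) ?_
    have h1 : ExteriorAlgebra.ιMulti R 0 (Matrix.vecTail v) = 1 :=
      ExteriorAlgebra.ιMulti_zero_apply _
    rw [h1]
    have h2 := CliffordAlgebra.contractLeft_one (Q := (0 : QuadraticForm R V)) φ
    refine h2.symm ▸ ?_
    simp
  | succ k ih =>
    rw [ExteriorAlgebra.ιMulti_succ_apply]
    have := CliffordAlgebra.contractLeft_ι_mul (Q := (0 : QuadraticForm R V)) φ (v 0)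
      (ExteriorAlgebra.ιMulti R (k+1) (Matrix.vecTail v))
    refine this ▸ ?_
    refine Submodule.sub_mem _ (Submodule.smul_mem _ _ (Submodule.subset_span ⟨_, rfl⟩)) ?_
    have h := ih (Matrix.vecTail v)
    generalize CliffordAlgebra.contractLeft (Q := (0 : QuadraticForm R V)) φ
      (ExteriorAlgebra.ιMulti R (k+1) (Matrix.vecTail v)) = X at h
    change ExteriorAlgebra.ι R (v 0) * (X : ExteriorAlgebra R V) ∈ _
    induction h using Submodule.span_induction with
    | mem x hx =>
      obtain ⟨w, rfl⟩ := hx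
      refine Submodule.subset_span ⟨Matrix.vecCons (v 0) w, ?_⟩
      rw [ExteriorAlgebra.ιMulti_succ_apply]
      simp
    | zero => rw [mul_zero]; exact Submodule.zero_mem _
    | add x y _ _ hx hy => rw [mul_add]; exact Submodule.add_mem _ hx hy
    | smul r x _ hx => rw [mul_smul_comm]; exact Submodule.smul_mem _ _ hx

theorem top_contract (m : ℕ) (φ : Module.Dual R (Fin m → R)) (X : ExteriorAlgebra R (Fin m → R)) :
    ExteriorAlgebra.liftAlternating (topf R m)
      (CliffordAlgebra.contractLeft (Q := (0 : QuadraticForm R (Fin m → R))) φ X) = 0 := by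
  have key : (ExteriorAlgebra.liftAlternating (topf R m)) ∘ₗ
      (CliffordAlgebra.contractLeft (Q := (0 : QuadraticForm R (Fin m → R))) φ :
        ExteriorAlgebra R (Fin m → R) →ₗ[R] ExteriorAlgebra R (Fin m → R)) = 0 := by
    apply ExteriorAlgebra.lhom_ext
    intro k
    ext v
    simp only [LinearMap.compAlternatingMap_apply, LinearMap.comp_apply, LinearMap.zero_apply]
    rcases k with _ | k
    · rw [ExteriorAlgebra.ιMulti_zero_apply]
      have h2 := CliffordAlgebra.contractLeft_one (Q := (0 : QuadraticForm R (Fin m → R))) φ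
      exact (congrArg _ h2).trans (map_zero _)
    · by_cases hk : k = m
      · subst hk
        have h0 : ExteriorAlgebra.ιMulti R (M := Fin k → R) (k+1) = 0 := by
          apply (Pi.basisFun R (Fin k)).ext_alternating
          intro w hw
          have := Fintype.card_le_of_injective w hw
          simp at this
        rw [h0]
        simp
      · have h := contract_mem φ k v
        generalize CliffordAlgebra.contractLeft (Q := (0 : QuadraticForm R (Fin m → R))) φ
          (ExteriorAlgebra.ιMulti R (k+1) v) = X at h
        change ExteriorAlgebra.liftAlternating (topf R m) (X : ExteriorAlgebra R (Fin m → R)) = 0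
        induction h using Submodule.span_induction with
        | mem x hx =>
          obtain ⟨w, rfl⟩ := hx
          rw [ExteriorAlgebra.liftAlternating_apply_ιMulti, topf_ne _ _ hk]
          rfl
        | zero => exact map_zero _
        | add x y _ _ hx hy => rw [map_add, hx, hy, add_zero]
        | smul r x _ hx => rw [map_smul, hx, smul_zero]
  exact LinearMap.congr_fun key X

/-- sum of maximal minors -/
def SS {m n : ℕ} (A : Matrix (Fin m) (Fin n) R) : R :=
  ∑ f ∈ incrFuns m n, (A.submatrix id f).det

/-- the matrix `A (2U+1) Aᵀ` -/
def QQ {m n : ℕ} (A : Matrix (Fin m) (Fin n) R) : Matrix (Fin m) (Fin m) R :=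
  A * MM R n * Aᵀ

theorem top_EE {m n : ℕ} (A : Matrix (Fin m) (Fin n) R) :
    ExteriorAlgebra.liftAlternating (topf R m) (EE (R := R) n (fun j r => A r j)) = SS A := by
  rw [lift_EE n _ _ (n + m + 1) (by omega), sum_eq_single m]
  · rw [topf_self]
    refine sum_congr rfl fun f _ => ?_
    rw [← det_transpose]
    rfl
  · intro k _ hk
    rw [topf_ne _ _ hk]
    simp
  · intro h
    simp at h

theorem top_ι_EE {m n : ℕ} (A : Matrix (Fin (m+1)) (Fin n) R) (p : Fin (m+1)) :
    ExteriorAlgebra.liftAlternating (topf R (m+1))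
      (ExteriorAlgebra.ι R (Pi.single p 1) * EE (R := R) n (fun j r => A r j))
      = (-1) ^ (p : ℕ) * SS (A.submatrix p.succAbove id) := by
  rw [ExteriorAlgebra.liftAlternating_ι_mul, lift_EE n _ _ (n + m + 1) (by omega), sum_eq_single m]
  · rw [topf_self, SS, mul_sum]
    refine sum_congr rfl fun f _ => ?_
    rw [AlternatingMap.curryLeft_apply_apply]
    change Matrix.det (Matrix.of (Matrix.vecCons (Pi.single p 1) fun i r => A r (f i))) = _
    rw [← det_transpose, det_succ_column_zero, sum_eq_single p]
    · simp
      congr 2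
    · intro b _ hb
      simp [hb]
    · simp
  · intro k _ hk
    rw [topf_ne _ _ (by omega)]
    simp
  · intro h
    simp at h

theorem key {m n : ℕ} (A : Matrix (Fin (m+1)) (Fin n) R) (r : Fin (m+1)) :
    ∑ p : Fin (m+1), ((-1) ^ (p : ℕ) * SS (A.submatrix p.succAbove id)) * QQ A p r
      = SS A * ∑ j, A r j := by
  have h := top_contract (m+1) (LinearMap.proj r) (EE (R := R) n (fun j r => A r j))
  rw [contract_EE, map_sub, map_smul, top_EE, sub_eq_zero] at h
  set q : Fin (m+1) → R := ∑ i, (∑ j, MM R n i j * (LinearMap.proj (R := R) (φ := fun _ : Fin (m+1) => R) r) (fun r => A r j)) • (fun r => A r i) with hq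
  have hq' : ∀ p, q p = QQ A p r := by
    intro p
    rw [QQ, Matrix.mul_assoc]
    simp only [hq, Finset.sum_apply, Pi.smul_apply, smul_eq_mul,
      Matrix.mul_apply, Matrix.transpose_apply, LinearMap.proj_apply]
    exact sum_congr rfl fun i _ => mul_comm _ _
  have h3 := LinearMap.pi_apply_eq_sum_univ ((ExteriorAlgebra.liftAlternating (topf R (m+1))) ∘ₗ
    (LinearMap.mulRight R (EE (R := R) n (fun j r => A r j))) ∘ₗ ExteriorAlgebra.ι R) q
  simp only [LinearMap.comp_apply, LinearMap.mulRight_apply] at h3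
  rw [h3] at h
  have h4 : ∀ p : Fin (m+1), (fun j => if p = j then (1:R) else 0) = Pi.single p 1 := by
    intro p; ext j; simp [Pi.single_apply, eq_comm]
  simp only [h4, top_ι_EE, hq', smul_eq_mul, LinearMap.proj_apply, Finset.sum_apply] at h
  rw [mul_comm (SS A), h]
  exact sum_congr rfl fun i _ => mul_comm _ _

theorem QQ_add_transpose {m n : ℕ} (A : Matrix (Fin m) (Fin n) R) :
    QQ A + (QQ A)ᵀ = (2 : R) • Matrix.vecMulVec (fun r => ∑ j, A r j) (fun r => ∑ j, A r j) := by
  have h : MM R n + (MM R n)ᵀ = (2 : R) • Matrix.vecMulVec (fun _ => 1) (fun _ => 1) := by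
    ext i j
    rcases lt_trichotomy i j with h | h | h
    · simp [MM, upperTri, vecMulVec_apply, h, h.not_gt, h.ne, h.ne']
    · simp [MM, upperTri, vecMulVec_apply, h]; norm_num
    · simp [MM, upperTri, vecMulVec_apply, h, h.not_gt, h.ne, h.ne']
  have h2 : QQ A + (QQ A)ᵀ = A * (MM R n + (MM R n)ᵀ) * Aᵀ := by
    unfold QQ
    generalize MM R n = M
    simp only [Matrix.transpose_mul, Matrix.transpose_transpose, Matrix.mul_add, Matrix.add_mul,
      Matrix.mul_assoc]
  rw [h2, h, Matrix.mul_smul, Matrix.smul_mul, Matrix.mul_vecMulVec, Matrix.vecMulVec_mul]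
  congr 2 <;> ext r <;> simp [Matrix.mulVec, Matrix.vecMul, dotProduct]

theorem adj_QQ {m n : ℕ} (A : Matrix (Fin (m+1)) (Fin n) R) (p : Fin (m+1)) :
    (QQ A).adjugate p p = (QQ (A.submatrix p.succAbove id)).det := by
  rw [adjugate_fin_succ_eq_det_submatrix, ← two_mul, pow_mul]
  simp only [even_two, Even.neg_pow, one_pow, one_mul]
  congr 1

theorem domain_step [IsDomain R] (h2 : (2 : R) ≠ 0) {m n : ℕ} (A : Matrix (Fin (m+1)) (Fin n) R)
    (p : Fin (m+1))
    (ih : SS (A.submatrix p.succAbove id) ^ 2 = (QQ (A.submatrix p.succAbove id)).det)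
    (hQ : (QQ A).det ≠ 0) (hQp : (QQ (A.submatrix p.succAbove id)).det ≠ 0) :
    SS A ^ 2 = (QQ A).det := by
  set L : Fin (m+1) → R := fun p => (-1) ^ (p : ℕ) * SS (A.submatrix p.succAbove id) with hL
  set s : Fin (m+1) → R := fun r => ∑ j, A r j with hs
  have hk : L ᵥ* QQ A = SS A • s := by
    ext r
    exact key A r
  set y := s ᵥ* (QQ A).adjugate with hy
  have h1 : (QQ A).det • L = SS A • y := by
    rw [hy, ← smul_vecMul, ← hk, vecMul_vecMul, mul_adjugate, vecMul_smul, vecMul_one]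
  have h3 : (2 : R) • vecMulVec y y = (QQ A).det • ((QQ A).adjugateᵀ + (QQ A).adjugate) := by
    have : (2 : R) • vecMulVec y y
        = (QQ A).adjugateᵀ * ((2 : R) • vecMulVec s s) * (QQ A).adjugate := by
      rw [Matrix.mul_smul, Matrix.smul_mul, Matrix.mul_vecMulVec, Matrix.vecMulVec_mul,
        Matrix.mulVec_transpose]
    rw [this, ← QQ_add_transpose, Matrix.mul_add, Matrix.add_mul, Matrix.mul_assoc, mul_adjugate,
      ← Matrix.transpose_mul, mul_adjugate]
    simp
  have h4 : y p * y p = (QQ A).det * L p ^ 2 := by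
    have := congrFun (congrFun h3 p) p
    simp only [Matrix.smul_apply, vecMulVec_apply, Matrix.add_apply, Matrix.transpose_apply,
      smul_eq_mul, adj_QQ, ← ih] at this
    apply mul_left_cancel₀ h2
    rw [this, hL]
    simp only [mul_pow, ← pow_mul, mul_comm (p : ℕ) 2]
    rw [pow_mul]
    simp only [even_two, Even.neg_pow, one_pow, one_mul]
    ring
  have h5 : (QQ A).det * L p = SS A * y p := congrFun h1 p
  have hLp : L p ^ 2 ≠ 0 := by
    rw [hL]
    simp only [mul_pow, ih]
    refine mul_ne_zero (pow_ne_zero _ (pow_ne_zero _ (by simp))) hQp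
  apply mul_right_cancel₀ (mul_ne_zero hQ hLp)
  calc SS A ^ 2 * ((QQ A).det * L p ^ 2) = (SS A * y p) ^ 2 := by rw [← h4]; ring
    _ = _ := by rw [← h5]; ring

theorem SS_map {R' : Type*} [CommRing R'] (f : R →+* R') {m n : ℕ} (A : Matrix (Fin m) (Fin n) R) :
    SS (A.map f) = f (SS A) := by
  rw [SS, SS, map_sum]
  refine sum_congr rfl fun g _ => ?_
  rw [RingHom.map_det]
  rfl

theorem QQ_map {R' : Type*} [CommRing R'] (f : R →+* R') {m n : ℕ} (A : Matrix (Fin m) (Fin n) R) :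
    (QQ (A.map f)).det = f (QQ A).det := by
  rw [RingHom.map_det]
  congr 1
  have hM : MM R' n = (MM R n).map f := by
    ext i j
    simp only [MM, upperTri, Matrix.add_apply, Matrix.smul_apply, Matrix.map_apply, Matrix.of_apply,
      Matrix.one_apply, map_add]
    split_ifs <;> simp [map_ofNat]
  rw [RingHom.mapMatrix_apply, QQ, QQ, Matrix.map_mul, Matrix.map_mul, hM, Matrix.transpose_map]

theorem det_QQ_of_lt [IsDomain R] {m n : ℕ} (h : n < m) (A : Matrix (Fin m) (Fin n) R) :
    (QQ A).det = 0 := by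
  have hli : ¬ LinearIndependent R (fun i => A i) := by
    intro hl
    have := hl.fintype_card_le_finrank
    simp at this
    omega
  rw [Fintype.not_linearIndependent_iff] at hli
  obtain ⟨g, hg, i, hi⟩ := hli
  rw [← exists_vecMul_eq_zero_iff]
  refine ⟨g, fun h => hi (by simp [h]), ?_⟩
  have : g ᵥ* A = 0 := by
    rw [← hg, vecMul_eq_sum]
  rw [QQ, Matrix.mul_assoc, ← vecMul_vecMul, this, zero_vecMul]

theorem SS_of_lt {m n : ℕ} (h : n < m) (A : Matrix (Fin m) (Fin n) R) : SS A = 0 := by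
  apply sum_eq_zero
  intro f hf
  simp only [incrFuns, mem_filter, mem_univ, true_and] at hf
  have hf' : StrictMono f := fun a b h => hf a b h
  have := Fintype.card_le_of_injective f hf'.injective
  simp at this
  omega

/-- the matrix `(I | 0)` -/
def A0 (m n : ℕ) : Matrix (Fin m) (Fin n) ℤ := Matrix.of fun i j => if (i : ℕ) = j then 1 else 0

theorem det_A0 {m n : ℕ} (h : m ≤ n) : (QQ (A0 m n)).det = 1 := by
  have e : QQ (A0 m n) = MM ℤ m := by
    ext i j
    have h1 : ∀ (i : Fin m) (k : Fin n), A0 m n i k = if Fin.castLE h i = k then 1 else 0 := by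
      intro i k
      simp [A0, Fin.ext_iff]
    simp only [QQ, Matrix.mul_apply, Matrix.transpose_apply, h1]
    simp [MM, upperTri, Matrix.one_apply]
  rw [e, det_of_isUpperTriangular]
  · simp [MM, upperTri]
  · intro i j hij
    have hij : j < i := hij
    simp [MM, upperTri, hij.not_gt, hij.ne']

theorem det_ne_zero_of_map {m n : ℕ} (h : m ≤ n) (A : Matrix (Fin m) (Fin n) R) (f : R →+* ℤ)
    (hf : A.map f = A0 m n) : (QQ A).det ≠ 0 := by
  intro h0
  have := QQ_map f A
  rw [hf, det_A0 h, h0, map_zero] at this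
  exact one_ne_zero this

end top

theorem transfer {m n : ℕ} (h : SS (mvPolynomialX (Fin m) (Fin n) ℤ) ^ 2
      = (QQ (mvPolynomialX (Fin m) (Fin n) ℤ)).det)
    {R : Type*} [CommRing R] (A : Matrix (Fin m) (Fin n) R) : SS A ^ 2 = (QQ A).det := by
  have hA : (mvPolynomialX (Fin m) (Fin n) ℤ).map
      (MvPolynomial.eval₂Hom (Int.castRingHom R) fun p : Fin m × Fin n => A p.1 p.2) = A :=
    mvPolynomialX_map_eval₂ _ A
  rw [← hA, SS_map, QQ_map, ← map_pow, h]

theorem generic (m n : ℕ) : SS (mvPolynomialX (Fin m) (Fin n) ℤ) ^ 2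
      = (QQ (mvPolynomialX (Fin m) (Fin n) ℤ)).det := by
  induction m with
  | zero => rw [SS, sum_incr_zero]; simp
  | succ m ih =>
    by_cases hmn : n < m + 1
    · rw [SS_of_lt hmn, det_QQ_of_lt hmn]; simp
    have hA : (mvPolynomialX (Fin (m+1)) (Fin n) ℤ).map
        (MvPolynomial.eval₂Hom (RingHom.id ℤ) fun p : Fin (m+1) × Fin n => A0 (m+1) n p.1 p.2)
        = A0 (m+1) n := mvPolynomialX_map_eval₂ _ _
    refine domain_step two_ne_zero _ (Fin.last m) (transfer ih _)
      (det_ne_zero_of_map (by omega) _ _ hA) (det_ne_zero_of_map (by omega) _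
        (MvPolynomial.eval₂Hom (RingHom.id ℤ) fun p : Fin (m+1) × Fin n => A0 (m+1) n p.1 p.2) ?_)
    ext i j
    have := congrFun (congrFun hA i.castSucc) j
    simp only [Matrix.map_apply, Matrix.submatrix_apply, Fin.succAbove_last, id] at this ⊢
    rw [this]
    simp [A0]

end Byun

/-- Byun's minor summation formula:
`(Σ_{I⊆[n], |I|=m} det(Aᴵ))² = det(A·(2U_n + Id_n)·Aᵗ)`. -/
theorem byun_minor_summation {R : Type*} [CommRing R] (m n : ℕ) (hm : 0 < m) (hn : 0 < n)
    (A : Matrix (Fin m) (Fin n) R) :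
    (∑ f ∈ incrFuns m n, (A.submatrix id f).det) ^ 2
      = (A * (2 • upperTri R n + 1) * Aᵀ).det := by
  exact Byun.transfer (Byun.generic m n) A
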